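/- Let a, c, e be complex numbers with e ≠ a, such that c is not a nonpositive integer, e and e+1−a−c+... Specifically, set f = e(c−a−1)/(e−a), and assume that e and f are nonzero and that neither e nor f is a nonpositive integer. Then for every complex x, ₂F₂(a, e+1; c, e; x) = e^x · ₂F₂(c−a−1, f+1; c, f; −x). -/

import Mathlib

/-- Pochhammer symbol `(a)_k` for complex `a`. -/
noncomputable def pochC (a : ℂ) (k : ℕ) : ℂ := (ascPochhammer ℂ k).eval a

/-- Hypergeometric series `₂F₂(a, b; c, d; x)`. -/
noncomputable def hyp2F2 (a b c d x : ℂ) : ℂ :=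
  ∑' k : ℕ, pochC a k * pochC b k * x ^ k / (pochC c k * pochC d k * (Nat.factorial k : ℂ))

open Finset Filter Topology

lemma pochC_zero (a : ℂ) : pochC a 0 = 1 := by simp [pochC]

lemma pochC_succ (a : ℂ) (k : ℕ) : pochC a (k+1) = pochC a k * (a + k) := by
  simp [pochC, ascPochhammer_succ_eval]

lemma pochC_succ_left (a : ℂ) (k : ℕ) : pochC a (k+1) = a * pochC (a+1) k := by
  simp [pochC, ascPochhammer_succ_left]

lemma pochC_ne (c : ℂ) (hc : ∀ k : ℕ, c ≠ -(k : ℂ)) (k : ℕ) : pochC c k ≠ 0 := by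
  induction k with
  | zero => simp [pochC_zero]
  | succ k ih =>
    rw [pochC_succ]
    exact mul_ne_zero ih (fun h => hc k (by linear_combination h))

lemma pochC_shift (e : ℂ) (k : ℕ) : e * pochC (e+1) k = pochC e k * (e + k) := by
  rw [← pochC_succ_left, pochC_succ]

lemma succ_ok (c : ℂ) (hc : ∀ k : ℕ, c ≠ -(k : ℂ)) : ∀ k : ℕ, c + 1 ≠ -(k : ℂ) := by
  intro k h
  apply hc (k+1)
  push_cast
  linear_combination h

/-- Chu-Vandermonde. -/
lemma chuV (n : ℕ) : ∀ (b c : ℂ), (∀ k : ℕ, c ≠ -(k : ℂ)) →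
    ∑ ij ∈ antidiagonal n, (n.choose ij.1 : ℂ) * ((-1)^ij.1 * pochC b ij.1 / pochC c ij.1)
      = pochC (c-b) n / pochC c n := by
  induction n with
  | zero => intro b c hc; simp [pochC_zero]
  | succ n ih =>
    intro b c hc
    have h := Finset.sum_antidiagonal_choose_succ_mul
      (fun i _ => (-1 : ℂ)^i * pochC b i / pochC c i) n
    rw [h, ih b c hc]
    have hc0 : c ≠ 0 := by simpa using hc 0
    have h2 : ∑ ij ∈ antidiagonal n, (n.choose ij.2 : ℂ) *
        ((-1)^(ij.1+1) * pochC b (ij.1+1) / pochC c (ij.1+1)) =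
        (-(b/c)) * (pochC (c-b) n / pochC (c+1) n) := by
      have := ih (b+1) (c+1) (succ_ok c hc)
      rw [show c + 1 - (b+1) = c - b by ring] at this
      rw [← this, Finset.mul_sum]
      apply Finset.sum_congr rfl
      intro ij hij
      have hch : n.choose ij.2 = n.choose ij.1 := by
        rw [HasAntidiagonal.mem_antidiagonal] at hij
        exact (Nat.choose_symm_of_eq_add (by omega))
      have := pochC_ne (c+1) (succ_ok c hc) ij.1
      rw [hch, pochC_succ_left, pochC_succ_left]
      field_simp
      ring
    rw [h2]
    have h3 := pochC_ne (c+1) (succ_ok c hc) n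
    have h4 := pochC_ne c hc n
    have h5 : c + n ≠ 0 := fun h => hc n (by linear_combination h)
    have h6 := pochC_shift c n
    have h7 : pochC (c+1) n = pochC c n * (c+n) / c := by
      field_simp; linear_combination h6
    rw [h7, pochC_succ, pochC_succ]
    field_simp
    ring

lemma chuV2 (n : ℕ) (b c : ℂ) (hc : ∀ k : ℕ, c ≠ -(k : ℂ)) :
    ∑ ij ∈ antidiagonal (n+1), ((n+1).choose ij.1 : ℂ) *
      ((-1)^ij.1 * pochC b ij.1 / pochC c ij.1 * ij.1)
      = -(n+1) * b * pochC (c-b) n / pochC c (n+1) := by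
  rw [Finset.Nat.sum_antidiagonal_succ]
  have hc0 : c ≠ 0 := by simpa using hc 0
  have h3 := pochC_ne (c+1) (succ_ok c hc) n
  have := chuV n (b+1) (c+1) (succ_ok c hc)
  rw [show c + 1 - (b+1) = c - b by ring] at this
  have e1 : -(n+1) * b * pochC (c-b) n / pochC c (n+1)
      = (-(n+1) * b / c) * (pochC (c-b) n / pochC (c+1) n) := by
    rw [pochC_succ_left]; field_simp
  rw [e1, ← this, Finset.mul_sum]
  simp only [Nat.cast_zero, mul_zero, zero_add]
  apply Finset.sum_congr rfl
  intro ij _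
  have hh := pochC_ne (c+1) (succ_ok c hc) ij.1
  have hch : ((n:ℂ)+1) * n.choose ij.1 = (n+1).choose (ij.1+1) * (ij.1+1) := by
    exact_mod_cast Nat.add_one_mul_choose_eq n ij.1
  rw [pochC_succ_left, pochC_succ_left]
  push_cast
  rw [pow_succ]
  field_simp
  linear_combination b * pochC (b+1) ij.1 * hch

lemma ratio_eq (e : ℂ) (he : ∀ k : ℕ, e ≠ -(k : ℂ)) (k : ℕ) :
    pochC (e+1) k / pochC e k = 1 + k / e := by
  have he0 : e ≠ 0 := by simpa using he 0
  have := pochC_ne e he k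
  field_simp
  linear_combination pochC_shift e k

lemma coeff_id (n : ℕ) (a c e f : ℂ) (hc : ∀ k : ℕ, c ≠ -(k : ℂ)) (he0 : e ≠ 0) (hf0 : f ≠ 0)
    (hfe : f * (e - a) = e * (c - a - 1)) :
    ∑ ij ∈ antidiagonal n, (n.choose ij.1 : ℂ) *
      ((-1)^ij.1 * pochC (c-a-1) ij.1 / pochC c ij.1 * (1 + ij.1 / f))
      = pochC a n / pochC c n * (1 + n / e) := by
  have hs : ∑ ij ∈ antidiagonal n, (n.choose ij.1 : ℂ) *
      ((-1)^ij.1 * pochC (c-a-1) ij.1 / pochC c ij.1 * (1 + ij.1 / f))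
      = ∑ ij ∈ antidiagonal n, (n.choose ij.1 : ℂ) *
          ((-1)^ij.1 * pochC (c-a-1) ij.1 / pochC c ij.1)
        + 1/f * ∑ ij ∈ antidiagonal n, (n.choose ij.1 : ℂ) *
          ((-1)^ij.1 * pochC (c-a-1) ij.1 / pochC c ij.1 * ij.1) := by
    rw [Finset.mul_sum, ← Finset.sum_add_distrib]
    apply Finset.sum_congr rfl
    intro ij _
    ring
  rw [hs, chuV n _ c hc]
  cases n with
  | zero => simp [pochC_zero]
  | succ n =>
    rw [chuV2 n _ c hc]
    have h4 := pochC_ne c hc (n+1)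
    rw [show c - (c - a - 1) = a + 1 by ring, pochC_succ_left a, pochC_succ (a+1)]
    push_cast
    field_simp
    linear_combination (n+1) * pochC (a+1) n * hfe

lemma summ (b c f x : ℂ) (hc : ∀ k : ℕ, c ≠ -(k : ℂ)) (hf : ∀ k : ℕ, f ≠ -(k : ℂ)) :
    Summable (fun k : ℕ => ‖pochC b k * pochC (f+1) k * x ^ k /
      (pochC c k * pochC f k * (Nat.factorial k : ℂ))‖) := by
  have t1 := tendsto_add_mul_div_add_mul_atTop_nhds b c (1:ℂ) (one_ne_zero)
  have t2 := tendsto_add_mul_div_add_mul_atTop_nhds (f+1) f (1:ℂ) (one_ne_zero)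
  have t3 : Tendsto (fun k : ℕ => x * (1 / ((k:ℂ)+1))) atTop (𝓝 (x * 0)) :=
    (tendsto_one_div_add_atTop_nhds_zero_nat (𝕜 := ℂ)).const_mul x
  have t := ((t1.mul t2).mul t3).norm
  simp only [mul_zero, norm_zero] at t
  have ev := t.eventually (eventually_le_nhds (show (0:ℝ) < 1/2 by norm_num))
  refine summable_of_ratio_norm_eventually_le (r := 1/2) (by norm_num) ?_
  filter_upwards [ev] with k hk
  rw [norm_norm, norm_norm]
  refine le_trans (le_of_eq ?_) (mul_le_mul_of_nonneg_right hk (norm_nonneg _))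
  rw [← norm_mul]
  congr 1
  have h1 := pochC_ne c hc k
  have h2 := pochC_ne f hf k
  have h3 : c + k ≠ 0 := fun h => hc k (by linear_combination h)
  have h4 : f + k ≠ 0 := fun h => hf k (by linear_combination h)
  have h5 : (k:ℂ) + 1 ≠ 0 := by exact_mod_cast Nat.succ_ne_zero k
  have h6 : (k.factorial : ℂ) ≠ 0 := by exact_mod_cast k.factorial_ne_zero
  rw [pochC_succ, pochC_succ, pochC_succ, pochC_succ, Nat.factorial_succ]
  push_cast
  simp only [one_mul]
  rw [pow_succ]
  field_simp

theorem stmt14 (a c e : ℂ) (hea : e ≠ a)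
    (hc : ∀ k : ℕ, c ≠ -(k : ℂ))
    (he0 : e ≠ 0)
    (hf0 : e * (c - a - 1) / (e - a) ≠ 0)
    (he : ∀ k : ℕ, e ≠ -(k : ℂ))
    (hf : ∀ k : ℕ, e * (c - a - 1) / (e - a) ≠ -(k : ℂ)) :
    ∀ x : ℂ,
      hyp2F2 a (e + 1) c e x
        = Complex.exp x *
            hyp2F2 (c - a - 1) (e * (c - a - 1) / (e - a) + 1) c
              (e * (c - a - 1) / (e - a)) (-x) := by
  intro x
  set f := e * (c - a - 1) / (e - a) with hfdef
  have hea' : e - a ≠ 0 := sub_ne_zero.mpr hea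
  have hfe : f * (e - a) = e * (c - a - 1) := by rw [hfdef]; field_simp
  have hexp : Complex.exp x = ∑' n : ℕ, x ^ n / (n.factorial : ℂ) := by
    rw [Complex.exp_eq_exp_ℂ, NormedSpace.exp_eq_tsum_div]
  unfold hyp2F2
  rw [mul_comm, hexp, tsum_mul_tsum_eq_tsum_sum_antidiagonal_of_summable_norm
    (summ _ c f (-x) hc hf) (NormedSpace.norm_expSeries_div_summable x)]
  congr 1
  funext n
  have key := coeff_id n a c e f hc he0 hf0 hfe
  have hn : (n.factorial : ℂ) ≠ 0 := by exact_mod_cast n.factorial_ne_zero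
  have hl : pochC a n * pochC (e+1) n * x ^ n / (pochC c n * pochC e n * (n.factorial : ℂ))
      = x ^ n / n.factorial * (pochC a n / pochC c n * (pochC (e+1) n / pochC e n)) := by
    have h1 := pochC_ne c hc n
    have h2 := pochC_ne e he n
    field_simp
  rw [hl, ratio_eq e he, ← key, Finset.mul_sum]
  apply Finset.sum_congr rfl
  rintro ⟨i, j⟩ hij
  rw [HasAntidiagonal.mem_antidiagonal] at hij
  simp only at hij ⊢
  subst hij
  rw [← ratio_eq f hf]
  have h1 := pochC_ne c hc i
  have h2 := pochC_ne f hf i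
  have hi : (i.factorial : ℂ) ≠ 0 := by exact_mod_cast i.factorial_ne_zero
  have hj : (j.factorial : ℂ) ≠ 0 := by exact_mod_cast j.factorial_ne_zero
  have hch : ((i+j).choose i : ℂ) * i.factorial * j.factorial = (i+j).factorial := by
    rw [Nat.choose_symm_add]
    exact_mod_cast Nat.add_choose_mul_factorial_mul_factorial i j
  rw [← hch] at hn ⊢
  have hcc : ((i+j).choose i : ℂ) ≠ 0 := fun h => hn (by rw [h]; ring)
  rw [neg_pow x, pow_add]
  field_simp
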